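/- arXiv:2211.15232 — 2 statements merged into one kernel-verified Lean document; each statement's English description precedes it below -/
import Mathlib

section
/- Assume d = 1 and that σ has drift at least 1: ∫_G σ(g,x) dμ(g) ≥ 1 for every x ∈ X. Then for every x ∈ X and every real n ≥ 3, β{b ∈ B : S_{τ_1(b,x)}(b,x) > n} ≤ μ{g ∈ G : |g| > n − 2} · ∫_B τ_1(b,x) dβ(b). -/
open MeasureTheory Filter Topology
open scoped ENNReal NNReal

noncomputable section

/-- The group element `b_n ⋯ b_1`, where `b_i` is coordinate `i - 1` of `b`. -/
def prodRev {G : Type*} [Monoid G] (b : ℕ → G) : ℕ → G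
  | 0 => 1
  | n + 1 => b n * prodRev b n

/-- The `n`-th convolution power of `μ`: the law of `b_n ⋯ b_1` for i.i.d. `b_i` of law `μ`. -/
def convPow {G : Type*} [Monoid G] [MeasurableSpace G] (μ : Measure G) : ℕ → Measure G
  | 0 => Measure.dirac 1
  | n + 1 => (μ.prod (convPow μ n)).map fun p => p.1 * p.2

/-- The σ-algebra on `ℕ → G` generated by the first `k` coordinates. -/
def coordSA (G : Type*) [MeasurableSpace G] (k : ℕ) : MeasurableSpace (ℕ → G) :=
  MeasurableSpace.comap (fun b (i : Fin k) => b i) MeasurableSpace.pi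

/-- The exit time `τ_s(b, x) = inf {n ≥ 1 : σ(b_n ⋯ b_1, x) ≥ s}`. -/
def exitTime {G : Type*} [Monoid G] {X : Type*} (σ : G → X → ℝ) (s : ℝ)
    (b : ℕ → G) (x : X) : ℕ :=
  sInf {n : ℕ | 1 ≤ n ∧ s ≤ σ (prodRev b n) x}


section Helpers

variable {G : Type*} [Group G] [MeasurableSpace G]

/-- Keep the first `k` coordinates, replace the others by `1`. -/
def truncSeq (k : ℕ) (b : ℕ → G) : ℕ → G := fun i => if i < k then b i else 1

/-- Extend a finite sequence by `1`. -/
def extSeq (k : ℕ) (v : Fin k → G) : ℕ → G := fun i => if h : i < k then v ⟨i, h⟩ else 1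

lemma measurable_truncSeq (k : ℕ) : Measurable (truncSeq (G := G) k) := by
  refine measurable_pi_iff.2 fun i => ?_
  unfold truncSeq
  by_cases h : i < k
  · simpa [h] using measurable_pi_apply i
  · simp [h]

lemma measurable_extSeq (k : ℕ) : Measurable (extSeq (G := G) k) := by
  refine measurable_pi_iff.2 fun i => ?_
  unfold extSeq
  by_cases h : i < k
  · simpa [h] using measurable_pi_apply _
  · simp [h]

lemma extSeq_restrict (k : ℕ) (b : ℕ → G) :
    extSeq k (fun i : Fin k => b i) = truncSeq k b := by
  funext i
  simp [extSeq, truncSeq]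

lemma prodRev_truncSeq (k : ℕ) (b : ℕ → G) (j : ℕ) (hj : j ≤ k) :
    prodRev (truncSeq k b) j = prodRev b j := by
  induction j with
  | zero => rfl
  | succ j ih =>
    have h : j < k := hj
    simp [prodRev, ih (by omega), truncSeq, h]

lemma measurable_prodRev [MeasurableMul₂ G] (k : ℕ) :
    Measurable fun b : ℕ → G => prodRev b k := by
  induction k with
  | zero => exact measurable_const
  | succ k ih => exact (measurable_pi_apply k).mul ih

lemma map_trunc_prod (μ : Measure G) [IsProbabilityMeasure μ]
    (β : Measure (ℕ → G)) [IsProbabilityMeasure β]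
    (hβ : ∀ n : ℕ, β.map (fun b (i : Fin n) => b i) = Measure.pi fun _ : Fin n => μ) (k : ℕ) :
    β.map (fun b => (b k, truncSeq k b)) = μ.prod (β.map (truncSeq k)) := by
  have hr : ∀ n : ℕ, Measurable fun (b : ℕ → G) (i : Fin n) => b i := fun n =>
    measurable_pi_iff.2 fun i => measurable_pi_apply _
  have h1 : β.map (truncSeq k) = (Measure.pi fun _ : Fin k => μ).map (extSeq k) := by
    rw [← hβ k, Measure.map_map (measurable_extSeq k) (hr k)]
    congr 1
  have h2 := (measurePreserving_piFinSuccAbove (fun _ : Fin (k+1) => μ) (Fin.last k)).map_eq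
  rw [← hβ (k+1), Measure.map_map (MeasurableEquiv.measurable _) (hr _)] at h2
  have h3 : (fun b : ℕ → G => (b k, truncSeq k b)) =
      (Prod.map id (extSeq k)) ∘ ((MeasurableEquiv.piFinSuccAbove (fun _ : Fin (k+1) => G)
        (Fin.last k)) ∘ fun (b : ℕ → G) (i : Fin (k+1)) => b i) := by
    funext b
    simp only [Function.comp, Prod.map]
    rw [← extSeq_restrict k b]
    simp [MeasurableEquiv.piFinSuccAbove, Fin.insertNthEquiv, Fin.removeNth, Fin.init]
    try rfl
  rw [h3, ← Measure.map_map (measurable_id.prodMap (measurable_extSeq k))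
    ((MeasurableEquiv.measurable _).comp (hr _)), h2,
    ← Measure.map_prod_map _ _ measurable_id (measurable_extSeq k), h1, Measure.map_id]

end Helpers

section Helpers2

variable {G : Type*} [Group G] {X : Type*}

/-- No exit during the first `k` steps. -/
def noExit (σ : G → X → ℝ) (x : X) (k : ℕ) : Set (ℕ → G) :=
  {b | ∀ i, 1 ≤ i → i ≤ k → σ (prodRev b i) x < 1}

lemma noExit_trunc [MeasurableSpace G] (σ : G → X → ℝ) (x : X) (k : ℕ) (b : ℕ → G) :
    truncSeq k b ∈ noExit σ x k ↔ b ∈ noExit σ x k := by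
  unfold noExit
  constructor
  · intro h i h1 h2
    have := h i h1 h2
    rwa [prodRev_truncSeq k b i h2] at this
  · intro h i h1 h2
    rw [prodRev_truncSeq k b i h2]
    exact h i h1 h2

lemma measurableSet_noExit [MeasurableSpace G] [MeasurableMul₂ G] [MeasurableSpace X]
    (σ : G → X → ℝ) (hσmeas : Measurable fun p : G × X => σ p.1 p.2) (x : X) (k : ℕ) :
    MeasurableSet (noExit σ x k) := by
  have : noExit σ x k = ⋂ i : ℕ, ⋂ (_ : 1 ≤ i), ⋂ (_ : i ≤ k),
      {b | σ (prodRev b i) x < 1} := by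
    ext b; simp [noExit]
  rw [this]
  refine MeasurableSet.iInter fun i => MeasurableSet.iInter fun _ => MeasurableSet.iInter fun _ => ?_
  exact measurableSet_lt
    (hσmeas.comp ((measurable_prodRev i).prodMk measurable_const)) measurable_const

lemma noExit_succ_subset (σ : G → X → ℝ) (x : X) (k : ℕ) :
    noExit σ x (k+1) ⊆ noExit σ x k := fun _ h i h1 h2 => h i h1 (by omega)

open Classical in
lemma stopped_le [MulAction G X] (σ : G → X → ℝ)
    (hcoc : ∀ g₁ g₂ : G, ∀ x : X, σ (g₂ * g₁) x = σ g₂ (g₁ • x) + σ g₁ x)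
    (x : X) (M : ℝ) (hM : 0 ≤ M) (b : ℕ → G) (k : ℕ) :
    (∑ j ∈ Finset.range k,
      (if b ∈ noExit σ x j then min (σ (b j) (prodRev b j • x)) M else 0) ≤ 1 + M) ∧
    (b ∈ noExit σ x k → ∑ j ∈ Finset.range k,
      (if b ∈ noExit σ x j then min (σ (b j) (prodRev b j • x)) M else 0)
        ≤ σ (prodRev b k) x) := by
  have h1 : σ 1 x = 0 := by
    have := hcoc 1 1 x
    simp at this
    exact this
  induction k with
  | zero => simp [prodRev, h1]; linarith
  | succ k ih =>
    rw [Finset.sum_range_succ]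
    by_cases hb : b ∈ noExit σ x k
    · have hS : σ (prodRev b k) x < 1 := by
        rcases Nat.eq_zero_or_pos k with h | h
        · subst h; simp [prodRev, h1]
        · exact hb k h le_rfl
      have h2 := ih.2 hb
      have h3 := min_le_left (σ (b k) (prodRev b k • x)) M
      have h4 := min_le_right (σ (b k) (prodRev b k • x)) M
      simp only [hb, if_true]
      refine ⟨by linarith, fun _ => ?_⟩
      simp only [prodRev, hcoc]
      linarith
    · simp only [hb, if_false, add_zero]
      exact ⟨ih.1, fun h => absurd (noExit_succ_subset σ x k h) hb⟩

end Helpers2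

lemma exists_trunc {G : Type*} [MeasurableSpace G] (N : G → ℝ) (hN0 : ∀ g, 0 ≤ N g)
    (μ : Measure G) (hmom1 : Integrable N μ) :
    ∃ M : ℕ, ∫ g, max (N g - M) 0 ∂μ < 1 / 2 := by
  have h : Tendsto (fun M : ℕ => ∫ g, max (N g - M) 0 ∂μ) atTop (𝓝 (∫ _, (0:ℝ) ∂μ)) := by
    refine tendsto_integral_of_dominated_convergence N (fun M => ?_) hmom1 (fun M => ?_) ?_
    · exact (hmom1.aestronglyMeasurable.sub aestronglyMeasurable_const).sup
        aestronglyMeasurable_const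
    · refine Eventually.of_forall fun g => ?_
      rw [Real.norm_of_nonneg (le_max_right _ _)]
      have : (0:ℝ) ≤ M := Nat.cast_nonneg M
      exact max_le (by linarith) (hN0 g)
    · refine Eventually.of_forall fun g => ?_
      refine tendsto_const_nhds.congr' ?_
      filter_upwards [eventually_ge_atTop ⌈N g⌉₊] with M hM
      have := Nat.ceil_le.1 hM
      exact (max_eq_right (by linarith)).symm
  simp only [integral_zero] at h
  exact (h.eventually (gt_mem_nhds (by norm_num : (0:ℝ) < 1/2))).exists

open Classical in
lemma drift_step
    {G : Type*} [Group G] [MeasurableSpace G] [MeasurableMul₂ G]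
    {X : Type*} [MeasurableSpace X]
    [MulAction G X] (hact : Measurable fun p : G × X => p.1 • p.2)
    (σ : G → X → ℝ)
    (hσmeas : Measurable fun p : G × X => σ p.1 p.2)
    (N : G → ℝ) (hNσ : ∀ g x, |σ g x| ≤ N g)
    (μ : Measure G) [IsProbabilityMeasure μ]
    (hmom1 : Integrable N μ)
    (hdrift : ∀ x, (1 : ℝ) ≤ ∫ g, σ g x ∂μ)
    (β : Measure (ℕ → G)) [IsProbabilityMeasure β]
    (hβ : ∀ n : ℕ, β.map (fun b (i : Fin n) => b i) = Measure.pi fun _ : Fin n => μ)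
    (M : ℕ) (hM : ∫ g, max (N g - M) 0 ∂μ < 1 / 2) (x : X) (j : ℕ) :
    Integrable (fun b : ℕ → G =>
      if b ∈ noExit σ x j then min (σ (b j) (prodRev b j • x)) (M:ℝ) else 0) β ∧
    1 / 2 * β.real (noExit σ x j) ≤ ∫ b : ℕ → G,
      (if b ∈ noExit σ x j then min (σ (b j) (prodRev b j • x)) (M:ℝ) else 0) ∂β := by
  have hM0 : (0:ℝ) ≤ M := Nat.cast_nonneg M
  have hA := measurableSet_noExit σ hσmeas x j
  have hAt : Measurable (truncSeq (G := G) j) := measurable_truncSeq j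
  have hmap := map_trunc_prod μ β hβ j
  haveI : IsProbabilityMeasure (β.map (truncSeq (G := G) j)) :=
    Measure.isProbabilityMeasure_map hAt.aemeasurable
  set P := β.map (truncSeq (G := G) j) with hP
  have hpair : Measurable fun b : ℕ → G => (b j, truncSeq j b) :=
    (measurable_pi_apply j).prodMk hAt
  set f : G × (ℕ → G) → ℝ := fun p =>
    if p.2 ∈ noExit σ x j then min (σ p.1 (prodRev p.2 j • x)) (M:ℝ) else 0 with hf
  have hfm : Measurable f := by
    refine Measurable.ite (measurable_snd hA) ?_ measurable_const
    refine Measurable.min ?_ measurable_const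
    exact hσmeas.comp (measurable_fst.prodMk
      (hact.comp (((measurable_prodRev j).comp measurable_snd).prodMk measurable_const)))
  have hfeq : (fun b : ℕ → G =>
      if b ∈ noExit σ x j then min (σ (b j) (prodRev b j • x)) (M:ℝ) else 0) =
      f ∘ fun b : ℕ → G => (b j, truncSeq j b) := by
    funext b
    simp only [hf, Function.comp, noExit_trunc, prodRev_truncSeq j b j le_rfl]
  have hbd : ∀ g y, |min (σ g y) (M:ℝ)| ≤ N g + M := by
    intro g y
    have h := abs_le.1 (hNσ g y)
    rw [abs_le]
    exact ⟨le_min (by linarith) (by linarith), (min_le_left _ _).trans (by linarith)⟩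
  have hfint : Integrable f (μ.prod P) := by
    refine Integrable.mono' (g := fun p : G × (ℕ → G) => N p.1 + M) ?_
      hfm.aestronglyMeasurable (Eventually.of_forall fun p => ?_)
    · exact (hmom1.comp_fst P).add (integrable_const _)
    · rw [Real.norm_eq_abs]
      simp only [hf]
      split_ifs
      · exact hbd _ _
      · have := (abs_nonneg _).trans (hbd p.1 x)
        simpa using this
  have hσm : ∀ y, Measurable fun g => σ g y := fun y =>
    hσmeas.comp (measurable_id.prodMk measurable_const)
  have hσint : ∀ y, Integrable (fun g => σ g y) μ := fun y =>
    hmom1.mono' (hσm y).aestronglyMeasurable (Eventually.of_forall fun g => hNσ g y)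
  have hmaxint : Integrable (fun g => max (N g - M) 0) μ :=
    (hmom1.sub (integrable_const _)).sup (integrable_const _)
  have hminint : ∀ y, Integrable (fun g => min (σ g y) (M:ℝ)) μ := fun y =>
    (hσint y).inf (integrable_const _)
  have hhalf : ∀ y, 1 / 2 ≤ ∫ g, min (σ g y) (M:ℝ) ∂μ := by
    intro y
    have h1 : ∫ g, (σ g y - max (N g - M) 0) ∂μ ≤ ∫ g, min (σ g y) (M:ℝ) ∂μ := by
      refine integral_mono ((hσint y).sub hmaxint) (hminint y) fun g => ?_
      have h := abs_le.1 (hNσ g y)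
      have h2 := le_max_left (N g - M) 0
      have h3 := le_max_right (N g - M) 0
      exact le_min (by linarith) (by linarith)
    rw [integral_sub (hσint y) hmaxint] at h1
    linarith [hdrift y]
  rw [hfeq]
  have hfint' : Integrable f (β.map fun b : ℕ → G => (b j, truncSeq j b)) := by
    rw [hmap]; exact hfint
  refine ⟨hfint'.comp_measurable hpair, ?_⟩
  have hPA : P.real (noExit σ x j) = β.real (noExit σ x j) := by
    rw [hP, map_measureReal_apply hAt hA]
    congr 1
    ext b
    exact noExit_trunc σ x j b
  have e : ∫ b, (f ∘ fun b : ℕ → G => (b j, truncSeq j b)) b ∂β = ∫ p, f p ∂(μ.prod P) := by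
    rw [← hmap, integral_map hpair.aemeasurable hfm.aestronglyMeasurable]
    rfl
  rw [e, integral_prod_symm f hfint, ← hPA]
  have : 1 / 2 * P.real (noExit σ x j) =
      ∫ c, (noExit σ x j).indicator (fun _ => (1/2:ℝ)) c ∂P := by
    rw [integral_indicator hA]; simp [mul_comm]
  rw [this]
  refine integral_mono ((integrable_const _).indicator hA) hfint.integral_prod_right fun c => ?_
  by_cases hc : c ∈ noExit σ x j
  · simpa [hf, hc] using hhalf (prodRev c j • x)
  · simp [hf, hc]

lemma sum_noExit_ne_top
    {G : Type*} [Group G] [MeasurableSpace G] [MeasurableMul₂ G]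
    {X : Type*} [MeasurableSpace X]
    [MulAction G X] (hact : Measurable fun p : G × X => p.1 • p.2)
    (σ : G → X → ℝ)
    (hσmeas : Measurable fun p : G × X => σ p.1 p.2)
    (hcoc : ∀ g₁ g₂ : G, ∀ x : X, σ (g₂ * g₁) x = σ g₂ (g₁ • x) + σ g₁ x)
    (N : G → ℝ) (hN0 : ∀ g, 0 ≤ N g) (hNσ : ∀ g x, |σ g x| ≤ N g)
    (μ : Measure G) [IsProbabilityMeasure μ]
    (hmom1 : Integrable N μ)
    (hdrift : ∀ x, (1 : ℝ) ≤ ∫ g, σ g x ∂μ)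
    (β : Measure (ℕ → G)) [IsProbabilityMeasure β]
    (hβ : ∀ n : ℕ, β.map (fun b (i : Fin n) => b i) = Measure.pi fun _ : Fin n => μ) (x : X) :
    ∑' k, β (noExit σ x k) ≠ ∞ := by
  classical
  obtain ⟨M, hM⟩ := exists_trunc N hN0 μ hmom1
  have hM0 : (0:ℝ) ≤ M := Nat.cast_nonneg M
  have hstep := drift_step hact σ hσmeas N hNσ μ hmom1 hdrift β hβ M hM x
  have hb : ∀ k, ∑ j ∈ Finset.range k, β.real (noExit σ x j) ≤ 2 * (1 + M) := by
    intro k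
    have h1 : ∑ j ∈ Finset.range k, 1 / 2 * β.real (noExit σ x j) ≤ 1 + M := by
      refine (Finset.sum_le_sum fun j _ => (hstep j).2).trans ?_
      rw [← integral_finsetSum _ fun j _ => (hstep j).1]
      calc _ ≤ ∫ _, (1 + M : ℝ) ∂β := by
            refine integral_mono (integrable_finsetSum _ fun j _ => (hstep j).1)
              (integrable_const _) fun b => ?_
            exact (stopped_le σ hcoc x M hM0 b k).1
        _ = 1 + M := by simp
    rw [← Finset.mul_sum] at h1
    linarith
  have hs : Summable fun j => β.real (noExit σ x j) :=
    summable_of_sum_range_le (fun _ => measureReal_nonneg) hb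
  have := hs.tsum_ofReal_ne_top
  simpa [Measure.real] using this

/-- tail bound for the overshoot at time tau_1. -/
theorem overshoot_tail_bound
    {G : Type*} [Group G] [MeasurableSpace G] [MeasurableMul₂ G]
    {X : Type*} [MetricSpace X] [CompactSpace X] [MeasurableSpace X] [BorelSpace X]
    [MulAction G X] (hact : Measurable fun p : G × X => p.1 • p.2)
    (σ : G → X → ℝ)
    (hσmeas : Measurable fun p : G × X => σ p.1 p.2)
    (hcoc : ∀ g₁ g₂ : G, ∀ x : X, σ (g₂ * g₁) x = σ g₂ (g₁ • x) + σ g₁ x)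
    (N : G → ℝ) (hN0 : ∀ g, 0 ≤ N g) (hNsub : ∀ g h : G, N (g * h) ≤ N g + N h)
    (hNσ : ∀ g x, |σ g x| ≤ N g)
    (μ : Measure G) [IsProbabilityMeasure μ]
    (hmom1 : Integrable N μ)
    (hdrift : ∀ x, (1 : ℝ) ≤ ∫ g, σ g x ∂μ)
    (β : Measure (ℕ → G)) [IsProbabilityMeasure β]
    (hβ : ∀ n : ℕ, β.map (fun b (i : Fin n) => b i) = Measure.pi fun _ : Fin n => μ) :
    ∀ x : X, ∀ n : ℝ, 3 ≤ n →
      β {b | n < σ (prodRev b (exitTime σ 1 b x)) x} ≤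
        μ {g | n - 2 < N g} * ∫⁻ b, (exitTime σ 1 b x : ℝ≥0∞) ∂β := by
  intro x n hn
  have h1x : σ 1 x = 0 := by
    have := hcoc 1 1 x
    simp at this
    exact this
  have hA := measurableSet_noExit σ hσmeas x
  have hfin := sum_noExit_ne_top hact σ hσmeas hcoc N hN0 hNσ μ hmom1 hdrift β hβ x
  -- the expected exit time
  have hexp : ∫⁻ b, (exitTime σ 1 b x : ℝ≥0∞) ∂β = ∑' k, β (noExit σ x k) := by
    have e1 : ∑' k, β (noExit σ x k) =
        ∫⁻ b, ∑' k, (noExit σ x k).indicator (fun _ => (1:ℝ≥0∞)) b ∂β := by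
      rw [lintegral_tsum fun k => (measurable_const.indicator (hA k)).aemeasurable]
      refine tsum_congr fun k => ?_
      rw [lintegral_indicator (hA k)]; simp
    rw [e1]
    refine lintegral_congr_ae ?_
    have hae := ae_eventually_notMem hfin
    filter_upwards [hae] with b hb
    obtain ⟨k, hk⟩ := hb.exists
    have hne : {n : ℕ | 1 ≤ n ∧ 1 ≤ σ (prodRev b n) x}.Nonempty := by
      by_contra hcon
      refine hk fun i hi _ => ?_
      by_contra hlt
      exact hcon ⟨i, hi, not_lt.1 hlt⟩
    have hmem := Nat.sInf_mem hne
    have hiff : ∀ k, b ∈ noExit σ x k ↔ k < exitTime σ 1 b x := by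
      intro k
      constructor
      · intro h
        by_contra hlt
        exact absurd hmem.2 (not_le.2 (h _ hmem.1 (not_lt.1 hlt)))
      · intro h i hi hik
        by_contra hlt
        have : exitTime σ 1 b x ≤ i := Nat.sInf_le ⟨hi, not_lt.1 hlt⟩
        omega
    have : ∀ k, (noExit σ x k).indicator (fun _ => (1:ℝ≥0∞)) b =
        if k ∈ Finset.range (exitTime σ 1 b x) then 1 else 0 := by
      intro k
      simp [Set.indicator, hiff]
    simp_rw [this]
    rw [tsum_eq_sum (s := Finset.range (exitTime σ 1 b x)) (fun k hk => by simp only [hk, if_false])]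
    rw [Finset.sum_congr rfl (fun k hk => if_pos hk)]
    simp
  rw [hexp]
  set E := toMeasurable μ {g | n - 2 < N g} with hE
  have hEm : MeasurableSet E := measurableSet_toMeasurable _ _
  have hsub : {b | n < σ (prodRev b (exitTime σ 1 b x)) x} ⊆
      ⋃ k : ℕ, {b | b k ∈ E ∧ b ∈ noExit σ x k} := by
    intro b hb
    simp only [Set.mem_setOf_eq] at hb
    rcases hk : exitTime σ 1 b x with _ | k
    · rw [hk] at hb
      simp only [prodRev, h1x] at hb
      linarith
    · rw [hk] at hb
      have hno : b ∈ noExit σ x k := by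
        intro i hi hik
        by_contra hlt
        have : exitTime σ 1 b x ≤ i := Nat.sInf_le ⟨hi, not_lt.1 hlt⟩
        omega
      have hS : σ (prodRev b k) x < 1 := by
        rcases Nat.eq_zero_or_pos k with h | h
        · subst h; simp [prodRev, h1x]
        · exact hno k h le_rfl
      refine Set.mem_iUnion.2 ⟨k, subset_toMeasurable _ _ ?_, hno⟩
      simp only [prodRev, hcoc] at hb
      have := le_abs_self (σ (b k) (prodRev b k • x))
      have := hNσ (b k) (prodRev b k • x)
      simp only [Set.mem_setOf_eq]
      linarith
  have hprod : ∀ k, β {b | b k ∈ E ∧ b ∈ noExit σ x k} =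
      μ {g | n - 2 < N g} * β (noExit σ x k) := by
    intro k
    have hAt : Measurable (truncSeq (G := G) k) := measurable_truncSeq k
    have hpair : Measurable fun b : ℕ → G => (b k, truncSeq k b) :=
      (measurable_pi_apply k).prodMk hAt
    haveI : IsProbabilityMeasure (β.map (truncSeq (G := G) k)) :=
      Measure.isProbabilityMeasure_map hAt.aemeasurable
    have h := congrArg (fun m => m (E ×ˢ noExit σ x k)) (map_trunc_prod μ β hβ k)
    beta_reduce at h
    rw [Measure.map_apply hpair (hEm.prod (hA k)), Measure.prod_prod,
      Measure.map_apply hAt (hA k), hE, measure_toMeasurable, ← hE] at h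
    have hs1 : (fun b : ℕ → G => (b k, truncSeq k b)) ⁻¹' (E ×ˢ noExit σ x k) =
        {b | b k ∈ E ∧ b ∈ noExit σ x k} := by
      ext b; simp [noExit_trunc]
    have hs2 : truncSeq k ⁻¹' (noExit σ x k) = noExit σ x k := by
      ext b; exact noExit_trunc σ x k b
    rw [hs1, hs2] at h
    exact h
  calc _ ≤ β (⋃ k : ℕ, {b | b k ∈ E ∧ b ∈ noExit σ x k}) := measure_mono hsub
    _ ≤ ∑' k, β {b | b k ∈ E ∧ b ∈ noExit σ x k} := measure_iUnion_le _
    _ = _ := by simp_rw [hprod]; rw [ENNReal.tsum_mul_left]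
end
end

section
/- Assume d = 1 and that μ has finite second moment. For every r > 1 there exist δ > 0, α > 0, c > 1 and C > 0 such that: if sup_{x∈X} ∫_G σ(g,x)² dμ(g) ≤ 1 + δ, then for every n ≥ 3 and every x ∈ X, β{b ∈ B : S_n(b,x) ≥ r a_n} ≤ C exp(−c log log n), where S_n(b,x) = Σ_{j=3}^{n} X^{(j)}(b_j, b_{j−1}⋯b_1·x) is the truncated recentered sum with truncation parameter α, and a_n = √(2 n log log n). -/
open MeasureTheory Filter Topology
open scoped ENNReal NNReal

noncomputable section

/-- The truncated increment X₁⁽ʲ⁾(g, y) = σ(g, y)·1_{|g| ≤ α √(j / log log j)}. -/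
def truncInc {G X : Type*} (σ : G → X → ℝ) (N : G → ℝ) (α : ℝ) (j : ℕ)
    (g : G) (y : X) : ℝ :=
  if N g ≤ α * Real.sqrt (j / Real.log (Real.log j)) then σ g y else 0

/-- The recentered truncated increment X⁽ʲ⁾(g, y) = X₁⁽ʲ⁾(g, y) − ∫ X₁⁽ʲ⁾(·, y) dμ. -/
def truncIncC {G X : Type*} [MeasurableSpace G] (σ : G → X → ℝ) (N : G → ℝ)
    (μ : Measure G) (α : ℝ) (j : ℕ) (g : G) (y : X) : ℝ :=
  truncInc σ N α j g y - ∫ g2, truncInc σ N α j g2 y ∂μ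

/-- The truncated recentered sum S_n(b, x) = ∑_{j=3}^n X⁽ʲ⁾(b_j, b_{j-1} ⋯ b_1 · x). -/
def truncSum {G X : Type*} [Monoid G] [MulAction G X] [MeasurableSpace G]
    (σ : G → X → ℝ) (N : G → ℝ) (μ : Measure G) (α : ℝ) (x : X)
    (n : ℕ) (b : ℕ → G) : ℝ :=
  ∑ j ∈ Finset.Icc 3 n, truncIncC σ N μ α j (b (j - 1)) (prodRev b (j - 1) • x)

/-- The normalisation a_n = √(2 n log log n). -/
def lilNorm (n : ℕ) : ℝ := Real.sqrt (2 * n * Real.log (Real.log n))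

lemma aux_exp_le (u e : ℝ) (hu : |u| ≤ e) :
    Real.exp u ≤ 1 + u + u ^ 2 / 2 * Real.exp e := by
  rcases eq_or_ne u 0 with rfl | h0
  · simp
  obtain ⟨x', hx', h⟩ := taylor_mean_remainder_lagrange_iteratedDeriv (f := Real.exp) (x := u)
    (x₀ := 0) (n := 1) h0.symm (Real.contDiff_exp.contDiffOn)
  have hu2 : UniqueDiffOn ℝ (Set.uIcc (0 : ℝ) u) := uniqueDiffOn_uIcc h0.symm
  have hd : derivWithin Real.exp (Set.uIcc (0 : ℝ) u) 0 = 1 := by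
    rw [(Real.hasDerivAt_exp 0).hasDerivWithinAt.derivWithin (hu2 0 (by simp))]; simp
  have hx2 : x' ≤ e := by
    have h1 : x' ≤ max 0 u := hx'.2.le
    have h2 : max 0 u ≤ e := max_le ((abs_nonneg u).trans hu) ((le_abs_self u).trans hu)
    linarith
  have h4 : Real.exp x' ≤ Real.exp e := Real.exp_le_exp.mpr hx2
  simp [taylorWithinEval_succ, iteratedDerivWithin_one, hd] at h
  norm_num [iteratedDeriv_eq_iterate] at h
  have := mul_le_mul_of_nonneg_right h4 (by positivity : 0 ≤ u ^ 2 / 2)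
  nlinarith

lemma aux_mgf {G : Type*} [MeasurableSpace G] (μ : Measure G) [IsProbabilityMeasure μ]
    (Y : G → ℝ) (hY : Measurable Y) (t : ℝ) (ht : ∀ g, |Y g| ≤ t) (V : ℝ)
    (hV : ∫ g, Y g ^ 2 ∂μ ≤ V) (l e : ℝ) (hl : 0 ≤ l) (hle : l * (2 * t) ≤ e) :
    ∫⁻ g, ENNReal.ofReal (Real.exp (l * (Y g - ∫ g', Y g' ∂μ))) ∂μ ≤
      ENNReal.ofReal (Real.exp (l ^ 2 / 2 * Real.exp e * V)) := by
  set m := ∫ g', Y g' ∂μ with hm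
  have hYi : Integrable Y μ := Integrable.of_bound hY.aestronglyMeasurable t
    (Eventually.of_forall ht)
  have hY2i : Integrable (fun g => Y g ^ 2) μ := by
    refine Integrable.of_bound (hY.pow_const 2).aestronglyMeasurable (t ^ 2)
      (Eventually.of_forall fun g => ?_)
    rw [Real.norm_eq_abs, abs_pow]
    exact pow_le_pow_left₀ (abs_nonneg _) (ht g) 2
  have hmt : |m| ≤ t := by
    have := norm_integral_le_of_norm_le_const (μ := μ) (f := Y) (C := t) (Eventually.of_forall ht)
    simpa using this
  have hZ : ∀ g, |l * (Y g - m)| ≤ e := fun g => by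
    rw [abs_mul, abs_of_nonneg hl]
    refine le_trans (mul_le_mul_of_nonneg_left ?_ hl) hle
    have := abs_sub (Y g) m
    have := ht g
    linarith
  set F : G → ℝ := fun g => 1 + l * (Y g - m) + (l * (Y g - m)) ^ 2 / 2 * Real.exp e with hF
  have hFe : F = fun g => (1 - l * m + l ^ 2 / 2 * Real.exp e * m ^ 2) +
      ((l - l ^ 2 * Real.exp e * m) * Y g + (l ^ 2 / 2 * Real.exp e) * Y g ^ 2) := by
    funext g; simp only [hF]; ring
  have hi1 := (hYi.const_mul (l - l ^ 2 * Real.exp e * m))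
  have hi2 := (hY2i.const_mul (l ^ 2 / 2 * Real.exp e))
  have hFi : Integrable F μ := by
    rw [hFe]; exact (integrable_const _).add (hi1.add hi2)
  have hint : ∫ g, F g ∂μ ≤ Real.exp (l ^ 2 / 2 * Real.exp e * V) := by
    have hi12 : Integrable (fun g => (l - l ^ 2 * Real.exp e * m) * Y g +
        (l ^ 2 / 2 * Real.exp e) * Y g ^ 2) μ := hi1.add hi2
    rw [hFe, integral_add (integrable_const _) hi12, integral_add hi1 hi2,
      integral_const_mul, integral_const_mul, ← hm]
    simp only [integral_const, probReal_univ, smul_eq_mul, one_mul]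
    have h1 := Real.add_one_le_exp (l ^ 2 / 2 * Real.exp e * V)
    have h2 : 0 ≤ l ^ 2 / 2 * Real.exp e := by positivity
    have h3 := mul_le_mul_of_nonneg_left hV h2
    have h4 : 0 ≤ l ^ 2 / 2 * Real.exp e * m ^ 2 := by positivity
    nlinarith
  have hle' : ∀ g, Real.exp (l * (Y g - m)) ≤ F g := fun g => aux_exp_le _ _ (hZ g)
  calc ∫⁻ g, ENNReal.ofReal (Real.exp (l * (Y g - m))) ∂μ
      ≤ ∫⁻ g, ENNReal.ofReal (F g) ∂μ := lintegral_mono fun g => ENNReal.ofReal_le_ofReal (hle' g)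
    _ = ENNReal.ofReal (∫ g, F g ∂μ) := (ofReal_integral_eq_lintegral_ofReal hFi
        (Eventually.of_forall fun g => (Real.exp_pos _).le.trans (hle' g))).symm
    _ ≤ _ := ENNReal.ofReal_le_ofReal hint

lemma aux_map {G : Type*} [MeasurableSpace G] (μ : Measure G) [IsProbabilityMeasure μ]
    (β : Measure (ℕ → G))
    (hβ : ∀ n : ℕ, β.map (fun b (i : Fin n) => b i) = Measure.pi fun _ : Fin n => μ) (n : ℕ) :
    β.map (fun b => (b n, fun i : Fin n => b i)) =
      μ.prod (β.map (fun b (i : Fin n) => b i)) := by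
  have h := (measurePreserving_piFinSuccAbove (fun _ : Fin (n + 1) => μ) (Fin.last n)).map_eq
  rw [hβ n, ← h, ← hβ (n + 1), Measure.map_map (MeasurableEquiv.measurable _) (by fun_prop)]
  congr 1
  funext b
  simp [MeasurableEquiv.piFinSuccAbove, Fin.insertNthEquiv]
  funext i
  simp [Fin.init]

lemma aux_step {G : Type*} [MeasurableSpace G] [One G] {X : Type*} [MeasurableSpace X]
    (μ : Measure G) [IsProbabilityMeasure μ]
    (β : Measure (ℕ → G)) [IsProbabilityMeasure β]
    (hβ : ∀ n : ℕ, β.map (fun b (i : Fin n) => b i) = Measure.pi fun _ : Fin n => μ) (n : ℕ)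
    (F : (ℕ → G) → ℝ≥0∞) (hF : Measurable F)
    (hFd : ∀ b b' : ℕ → G, (∀ i < n, b i = b' i) → F b = F b')
    (Z : (ℕ → G) → X) (hZ : Measurable Z)
    (hZd : ∀ b b' : ℕ → G, (∀ i < n, b i = b' i) → Z b = Z b')
    (H : G × X → ℝ≥0∞) (hH : Measurable H) (M : ℝ≥0∞) (hM : ∀ y, ∫⁻ g, H (g, y) ∂μ ≤ M) :
    ∫⁻ b, F b * H (b n, Z b) ∂β ≤ (∫⁻ b, F b ∂β) * M := by
  set ext : (Fin n → G) → ℕ → G := fun c i => if h : i < n then c ⟨i, h⟩ else 1 with hext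
  have hem : Measurable ext := by
    refine measurable_pi_iff.2 fun i => ?_
    by_cases h : i < n
    · simpa [hext, h] using measurable_pi_apply _
    · simp [hext, h]
  have hag : ∀ b : ℕ → G, ∀ i < n, b i = ext (fun i : Fin n => b i) i := by
    intro b i hi; simp [hext, hi]
  have hprob : IsProbabilityMeasure (β.map (fun b (i : Fin n) => b i)) :=
    Measure.isProbabilityMeasure_map (Measurable.aemeasurable (by fun_prop))
  have hKm : Measurable fun p : G × (Fin n → G) => F (ext p.2) * H (p.1, Z (ext p.2)) := by
    fun_prop
  calc ∫⁻ b, F b * H (b n, Z b) ∂β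
      = ∫⁻ b, (fun p : G × (Fin n → G) => F (ext p.2) * H (p.1, Z (ext p.2)))
          (b n, fun i : Fin n => b i) ∂β := by
        refine lintegral_congr fun b => ?_
        simp only
        rw [← hFd b _ (hag b), ← hZd b _ (hag b)]
    _ = ∫⁻ p, F (ext p.2) * H (p.1, Z (ext p.2)) ∂(β.map (fun b => (b n, fun i : Fin n => b i))) :=
        (lintegral_map hKm (by fun_prop)).symm
    _ = ∫⁻ c, ∫⁻ g, F (ext c) * H (g, Z (ext c)) ∂μ ∂(β.map (fun b (i : Fin n) => b i)) := by
        rw [aux_map μ β hβ n, lintegral_prod_symm _ hKm.aemeasurable]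
    _ ≤ ∫⁻ c, F (ext c) * M ∂(β.map (fun b (i : Fin n) => b i)) := by
        refine lintegral_mono fun c => ?_
        simp only
        rw [lintegral_const_mul _ (by fun_prop)]
        gcongr
        exact hM _
    _ = ∫⁻ b, F b * M ∂β := by
        rw [lintegral_map (by fun_prop) (by fun_prop)]
        refine lintegral_congr fun b => ?_
        rw [← hFd b _ (hag b)]
    _ = _ := lintegral_mul_const _ hF

lemma aux_LL3 : 0 < Real.log (Real.log 3) :=
  Real.log_pos (by
    rw [Real.lt_log_iff_exp_lt (by norm_num)]
    exact Real.exp_one_lt_d9.trans (by norm_num))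

lemma aux_LL_mono (m n : ℕ) (hm : 3 ≤ m) (hmn : m ≤ n) :
    Real.log (Real.log m) ≤ Real.log (Real.log n) := by
  have h3 : (3 : ℝ) ≤ m := by exact_mod_cast hm
  have hmn' : (m : ℝ) ≤ n := by exact_mod_cast hmn
  exact Real.log_le_log (Real.log_pos (by linarith)) (Real.log_le_log (by linarith) hmn')

/-- comparison of the truncation levels -/
lemma aux_ratio (j n : ℕ) (hj : 3 ≤ j) (hjn : j ≤ n) :
    (j : ℝ) / Real.log (Real.log j) ≤
      (1 + 1 / Real.log (Real.log 3)) * (n / Real.log (Real.log n)) := by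
  have h3 : (3 : ℝ) ≤ j := by exact_mod_cast hj
  have hjn' : (j : ℝ) ≤ n := by exact_mod_cast hjn
  have hp3 := aux_LL3
  have h3j := aux_LL_mono 3 j le_rfl hj
  have hjnL := aux_LL_mono j n hj hjn
  push_cast at h3j
  have hlj : 0 < Real.log j := Real.log_pos (by linarith)
  have hln : 0 < Real.log n := Real.log_pos (by linarith)
  have he : Real.exp 1 ≤ 3 := (Real.exp_one_lt_d9.trans (by norm_num)).le
  have hanti := Real.log_div_self_antitoneOn (show (j : ℝ) ∈ Set.Ici (Real.exp 1) from
    he.trans h3) (show (n : ℝ) ∈ Set.Ici (Real.exp 1) from he.trans (h3.trans hjn')) hjn'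
  simp only at hanti
  have hj0 : (0 : ℝ) < j := by linarith
  have hn0 : (0 : ℝ) < n := by linarith
  have hq : Real.log n / Real.log j ≤ n / j := by
    rw [div_le_div_iff₀ hn0 hj0] at hanti
    rw [div_le_div_iff₀ hlj hj0]; linarith
  have h1 : Real.log (Real.log n) - Real.log (Real.log j) ≤ n / j := by
    rw [← Real.log_div hln.ne' hlj.ne']
    have := Real.log_le_sub_one_of_pos (div_pos hln hlj)
    linarith
  set a := Real.log (Real.log 3)
  set u := Real.log (Real.log j)
  set v := Real.log (Real.log n)
  have hu : 0 < u := by linarith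
  have hv : 0 < v := by linarith
  have h2 : v * j ≤ (1 + 1 / a) * n * u := by
    have h5 : (v - u) * j ≤ n := by
      rwa [le_div_iff₀ hj0] at h1
    have h6 : (n : ℝ) ≤ 1 / a * n * u := by
      have : 1 ≤ 1 / a * u := by rw [one_div, inv_mul_eq_div, one_le_div hp3]; exact h3j
      nlinarith
    nlinarith
  rw [← mul_div_assoc, div_le_div_iff₀ hu hv]
  linarith

lemma prodRev_congr {G : Type*} [Monoid G] (n : ℕ) (b b' : ℕ → G) (h : ∀ i < n, b i = b' i) :
    prodRev b n = prodRev b' n := by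
  induction n with
  | zero => rfl
  | succ k ih =>
    simp only [prodRev]
    rw [h k (by omega), ih fun i hi => h i (by omega)]

lemma prodRev_measurable {G : Type*} [Monoid G] [MeasurableSpace G] [MeasurableMul₂ G] (n : ℕ) :
    Measurable fun b : ℕ → G => prodRev b n := by
  induction n with
  | zero => exact measurable_const
  | succ k ih =>
    simp only [prodRev]
    exact (measurable_pi_apply k).mul ih

/-- Bound for the expectation of a product of functions along the walk. -/
lemma aux_prod {G : Type*} [Group G] [MeasurableSpace G] [MeasurableMul₂ G]
    {X : Type*} [MeasurableSpace X] [MulAction G X]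
    (hact : Measurable fun p : G × X => p.1 • p.2)
    (μ : Measure G) [IsProbabilityMeasure μ]
    (β : Measure (ℕ → G)) [IsProbabilityMeasure β]
    (hβ : ∀ n : ℕ, β.map (fun b (i : Fin n) => b i) = Measure.pi fun _ : Fin n => μ) (n : ℕ)
    (H : ℕ → G × X → ℝ≥0∞) (hH : ∀ j, Measurable (H j)) (M : ℝ≥0∞) (hM1 : 1 ≤ M)
    (hM : ∀ j, 3 ≤ j → j ≤ n → ∀ y, ∫⁻ g, H j (g, y) ∂μ ≤ M) (x : X) (k : ℕ) (hk : k ≤ n) :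
    ∫⁻ b, ∏ j ∈ Finset.Icc 3 k, H j (b (j - 1), prodRev b (j - 1) • x) ∂β ≤ M ^ k := by
  have hZm : ∀ i, Measurable fun b : ℕ → G => prodRev b i • x := fun i =>
    hact.comp ((prodRev_measurable i).prodMk measurable_const)
  induction k with
  | zero => simp
  | succ k ih =>
    by_cases h3 : 3 ≤ k + 1
    · simp only [Finset.prod_Icc_succ_top h3]
      have := aux_step μ β hβ k
        (fun b => ∏ j ∈ Finset.Icc 3 k, H j (b (j - 1), prodRev b (j - 1) • x))
        (Finset.measurable_prod _ fun j _ => (hH j).comp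
          ((measurable_pi_apply (j - 1)).prodMk (hZm (j - 1))))
        (fun b b' hb => Finset.prod_congr rfl fun j hj => by
          rw [Finset.mem_Icc] at hj
          rw [hb (j - 1) (by omega), prodRev_congr (j - 1) b b' fun i hi => hb i (by omega)])
        (fun b => prodRev b k • x) (hZm k)
        (fun b b' hb => by rw [prodRev_congr k b b' hb])
        (H (k + 1)) (hH _) M (hM _ h3 hk)
      refine le_trans this ?_
      rw [pow_succ]
      gcongr
      exact ih (by omega)
    · rw [Finset.Icc_eq_empty (by omega)]
      simpa using one_le_pow₀ hM1

/-- exponential bound on the truncated recentered sums. -/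
theorem truncated_sum_bound
    {G : Type*} [Group G] [MeasurableSpace G] [MeasurableMul₂ G]
    {X : Type*} [MetricSpace X] [CompactSpace X] [MeasurableSpace X] [BorelSpace X]
    [MulAction G X] (hact : Measurable fun p : G × X => p.1 • p.2)
    (σ : G → X → ℝ)
    (hσmeas : Measurable fun p : G × X => σ p.1 p.2)
    (hcoc : ∀ g₁ g₂ : G, ∀ x : X, σ (g₂ * g₁) x = σ g₂ (g₁ • x) + σ g₁ x)
    (N : G → ℝ) (hN0 : ∀ g, 0 ≤ N g) (hNsub : ∀ g h : G, N (g * h) ≤ N g + N h)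
    (hNσ : ∀ g x, |σ g x| ≤ N g)
    (μ : Measure G) [IsProbabilityMeasure μ]
    (hmom1 : Integrable N μ)
    (hdrift : ∀ x, ∫ g, σ g x ∂μ = 0)
    (hmom2 : Integrable (fun g => N g ^ 2) μ)
    (β : Measure (ℕ → G)) [IsProbabilityMeasure β]
    (hβ : ∀ n : ℕ, β.map (fun b (i : Fin n) => b i) = Measure.pi fun _ : Fin n => μ) :
    ∀ r : ℝ, 1 < r → ∃ δ > (0 : ℝ), ∃ α > (0 : ℝ), ∃ c : ℝ, 1 < c ∧ ∃ C > (0 : ℝ),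
      (∀ x : X, ∫ g, (σ g x) ^ 2 ∂μ ≤ 1 + δ) →
        ∀ n : ℕ, 3 ≤ n → ∀ x : X,
          β {b | r * lilNorm n ≤ truncSum σ N μ α x n b} ≤
            ENNReal.ofReal (C * Real.exp (-c * Real.log (Real.log n))) := by
  intro r hr
  have hr0 : 0 < r := by linarith
  have hp3 := aux_LL3
  obtain ⟨K, hK⟩ : ∃ K, K = 1 + 1 / Real.log (Real.log 3) := ⟨_, rfl⟩
  have hK0 : 0 < K := by rw [hK]; positivity
  have hlr : 0 < Real.log r := Real.log_pos hr
  have hsK : 0 < Real.sqrt (2 * K) := Real.sqrt_pos.mpr (by positivity)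
  obtain ⟨α, hα⟩ : ∃ α, α = Real.log r / (2 * Real.sqrt (2 * K)) := ⟨_, rfl⟩
  have hα0 : 0 < α := by rw [hα]; positivity
  refine ⟨(r - 1) / (2 * r), by have : 0 < r - 1 := by linarith
                                positivity, α, hα0, (r + 1) / 2, by linarith,
    1, one_pos, ?_⟩
  intro hvar n hn x
  set V : ℝ := 1 + (r - 1) / (2 * r) with hVdef
  have hV0 : 0 < V := by
    have : 0 < (r - 1) / (2 * r) := div_pos (by linarith) (by linarith)
    linarith
  set L : ℝ := Real.log (Real.log n) with hL
  have hL0 : 0 < L := by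
    have := aux_LL_mono 3 n le_rfl hn
    push_cast at this
    linarith
  have hn0 : (0 : ℝ) < n := by
    have : 0 < n := by omega
    exact_mod_cast this
  set t : ℕ → ℝ := fun j => α * Real.sqrt (j / Real.log (Real.log j)) with ht
  have ht0 : ∀ j, 0 ≤ t j := fun j => by positivity
  -- measurable truncation sets
  have hA : ∀ j, ∃ A ⊆ {g | N g ≤ t j}, MeasurableSet A ∧ A =ᵐ[μ] {g | N g ≤ t j} := fun j =>
    (hmom1.1.aemeasurable.nullMeasurable measurableSet_Iic :
      NullMeasurableSet {g | N g ≤ t j} μ).exists_measurable_subset_ae_eq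
  choose A hAsub hAm hAe using hA
  have hσx : ∀ y, Measurable fun g => σ g y := fun y =>
    hσmeas.comp (measurable_id.prodMk measurable_const)
  set Y : ℕ → G → X → ℝ := fun j g y => (A j).indicator (fun g => σ g y) g with hY
  have hYg : ∀ j y, Measurable fun g => Y j g y := fun j y => (hσx y).indicator (hAm j)
  have hYj : ∀ j, Measurable fun p : G × X => Y j p.1 p.2 := fun j => by
    have := hσmeas.indicator (measurable_fst (hAm j) : MeasurableSet (Prod.fst ⁻¹' (A j)))
    exact this
  have hYb : ∀ j g y, |Y j g y| ≤ t j := fun j g y => by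
    simp only [hY, Set.indicator]
    split_ifs with h
    · exact (hNσ g y).trans (hAsub j h)
    · simpa using ht0 j
  have hYsq : ∀ j y, ∫ g, Y j g y ^ 2 ∂μ ≤ V := fun j y => by
    refine le_trans ?_ (hvar y)
    refine integral_mono_of_nonneg (Eventually.of_forall fun g => sq_nonneg _) ?_
      (Eventually.of_forall fun g => ?_)
    · refine hmom2.mono' ((hσx y).pow_const 2).aestronglyMeasurable
        (Eventually.of_forall fun g => ?_)
      rw [Real.norm_eq_abs, abs_pow]
      exact pow_le_pow_left₀ (abs_nonneg _) (hNσ g y) 2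
    · simp only [hY, Set.indicator]
      split_ifs with h
      · exact le_rfl
      · simpa using sq_nonneg (σ g y)
  have hae : ∀ j, ∀ᵐ g ∂μ, ∀ y, truncInc σ N α j g y = Y j g y := fun j => by
    filter_upwards [(hAe j).mem_iff] with g hg y
    simp only [truncInc, hY, Set.indicator, hg, ht]
  have hint : ∀ j y, ∫ g, truncInc σ N α j g y ∂μ = ∫ g, Y j g y ∂μ := fun j y => by
    refine integral_congr_ae ?_
    filter_upwards [hae j] with g hg using hg y
  have hmap : ∀ i, β.map (fun b : ℕ → G => b i) = μ := fun i => by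
    have h := congrArg (Measure.map Prod.fst) (aux_map μ β hβ i)
    have hprob : IsProbabilityMeasure (β.map (fun b (j : Fin i) => b j)) :=
      Measure.isProbabilityMeasure_map (Measurable.aemeasurable (by fun_prop))
    rw [Measure.map_map measurable_fst (by fun_prop), Measure.map_fst_prod] at h
    simpa [Function.comp_def] using h
  have haeb : ∀ᵐ b ∂β, ∀ j, ∀ y, truncInc σ N α j (b (j - 1)) y = Y j (b (j - 1)) y := by
    rw [ae_all_iff]
    intro j
    have h := hae j
    rw [← hmap (j - 1)] at h
    exact ae_of_ae_map (measurable_pi_apply (j - 1)).aemeasurable h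
  set l : ℝ := Real.sqrt (2 * L / n) with hl
  have hl0 : 0 ≤ l := Real.sqrt_nonneg _
  have hlsq : l ^ 2 = 2 * L / n := Real.sq_sqrt (by positivity)
  have hla : l * lilNorm n = 2 * L := by
    rw [hl, lilNorm, ← hL, ← Real.sqrt_mul (by positivity),
      show 2 * L / n * (2 * n * L) = (2 * L) ^ 2 by field_simp, Real.sqrt_sq (by positivity)]
  have hlt : ∀ j, 3 ≤ j → j ≤ n → l * (2 * t j) ≤ Real.log r := fun j h3 hjn => by
    have h1 : Real.sqrt (j / Real.log (Real.log j)) ≤ Real.sqrt (K * (n / L)) := by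
      apply Real.sqrt_le_sqrt
      rw [hK]
      exact aux_ratio j n h3 hjn
    have h2 : l * Real.sqrt (K * (n / L)) = Real.sqrt (2 * K) := by
      rw [hl, ← Real.sqrt_mul (by positivity)]
      congr 1
      field_simp
    calc l * (2 * t j) = 2 * α * (l * Real.sqrt (j / Real.log (Real.log j))) := by
          simp only [ht]; ring
      _ ≤ 2 * α * (l * Real.sqrt (K * (n / L))) := by gcongr
      _ = Real.log r := by rw [h2, hα]; field_simp
  set W : ℕ → G × X → ℝ := fun j p => Y j p.1 p.2 - ∫ g, Y j g p.2 ∂μ with hW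
  have hWm : ∀ j, Measurable (W j) := fun j => by
    have h1 : Measurable fun y => ∫ g, Y j g y ∂μ :=
      ((hYj j).stronglyMeasurable.integral_prod_left' (μ := μ)).measurable
    exact (hYj j).sub (h1.comp measurable_snd)
  set H : ℕ → G × X → ℝ≥0∞ := fun j p => ENNReal.ofReal (Real.exp (l * W j p)) with hH
  have hHm : ∀ j, Measurable (H j) := fun j =>
    (Real.measurable_exp.comp ((hWm j).const_mul l)).ennreal_ofReal
  set q : ℝ := l ^ 2 / 2 * r * V with hq
  have hq0 : 0 ≤ q := by positivity
  have hbound := aux_prod hact μ β hβ n H hHm (ENNReal.ofReal (Real.exp q))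
    (by rw [ENNReal.one_le_ofReal]; exact Real.one_le_exp hq0)
    (fun j h3 hjn y => by
      have := aux_mgf μ (fun g => Y j g y) (hYg j y) (t j) (fun g => hYb j g y) V (hYsq j y) l
        (Real.log r) hl0 (hlt j h3 hjn)
      rwa [Real.exp_log hr0] at this) x n le_rfl
  set S : (ℕ → G) → ℝ := fun b => ∑ j ∈ Finset.Icc 3 n, W j (b (j - 1), prodRev b (j - 1) • x)
    with hS
  have hZm : ∀ i, Measurable fun b : ℕ → G => prodRev b i • x := fun i =>
    hact.comp ((prodRev_measurable i).prodMk measurable_const)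
  have hSm : Measurable S := Finset.measurable_sum _ fun j _ => (hWm j).comp
    ((measurable_pi_apply (j - 1)).prodMk (hZm (j - 1)))
  have hprod : ∀ b, ∏ j ∈ Finset.Icc 3 n, H j (b (j - 1), prodRev b (j - 1) • x) =
      ENNReal.ofReal (Real.exp (l * S b)) := fun b => by
    simp only [hH, hS]
    rw [← ENNReal.ofReal_prod_of_nonneg (fun _ _ => (Real.exp_pos _).le), ← Real.exp_sum,
      Finset.mul_sum]
  simp only [hprod] at hbound
  have hmark := mul_meas_ge_le_lintegral (μ := β)
    (f := fun b => ENNReal.ofReal (Real.exp (l * S b)))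
    (Real.measurable_exp.comp (hSm.const_mul l)).ennreal_ofReal
    (ENNReal.ofReal (Real.exp (r * (2 * L))))
  have hsub : β {b | r * lilNorm n ≤ truncSum σ N μ α x n b} ≤
      β {b | ENNReal.ofReal (Real.exp (r * (2 * L))) ≤ ENNReal.ofReal (Real.exp (l * S b))} := by
    apply measure_mono_ae
    filter_upwards [haeb] with b hb hmem
    have hSb : truncSum σ N μ α x n b = S b := by
      simp only [truncSum, truncIncC, hS, hW, hb, hint]
    have hmem' : r * lilNorm n ≤ truncSum σ N μ α x n b := hmem
    rw [hSb] at hmem'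
    show ENNReal.ofReal _ ≤ ENNReal.ofReal _
    apply ENNReal.ofReal_le_ofReal
    apply Real.exp_le_exp.mpr
    have := mul_le_mul_of_nonneg_left hmem' hl0
    rw [← hla]
    linarith
  have hfin := hmark.trans hbound
  rw [← ENNReal.ofReal_pow (Real.exp_pos _).le, ← Real.exp_nat_mul] at hfin
  have hexp : Real.exp (n * q) = Real.exp (r * (2 * L)) *
      (1 * Real.exp (-((r + 1) / 2) * L)) := by
    rw [one_mul, ← Real.exp_add]
    congr 1
    rw [hq, hlsq, hVdef]
    field_simp
    ring
  rw [hexp, ENNReal.ofReal_mul (Real.exp_pos _).le] at hfin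
  refine hsub.trans ?_
  exact (ENNReal.mul_le_mul_iff_right (by simpa using Real.exp_pos _) ENNReal.ofReal_ne_top).mp hfin
end
end
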